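/- arXiv:2101.03488 — 2 statements merged into one kernel-verified Lean document; each statement's English description precedes it below -/
import Mathlib

section
/- For every λ ∈ ℤ and every f ∈ 𝒜_λ one has the identity K(R·f) = (λ − c_G)·f − R·K(f) in 𝒜. -/
open MvPolynomial

namespace PeriodCI

/-- The coordinate ring `A = ℂ[q_1,…,q_N]`, `N = n+k+1`, with `q_1,…,q_k` the `y`-variables
and `q_{k+1},…,q_N` the `x`-variables. -/
abbrev CoordRing (n k : ℕ) := MvPolynomial (Fin (n + k + 1)) ℂ

/-- The super-algebra `𝒜 = A[η_1,…,η_N]`, modelled as functions from subsets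
`T ⊆ {1,…,N}` (the monomial `η_T`) to `A`. -/
abbrev SuperAlg (n k : ℕ) := Finset (Fin (n + k + 1)) → CoordRing n k

/-- the variable `y_i` among the `q`'s. -/
def yVar (n k : ℕ) (i : Fin k) : Fin (n + k + 1) := ⟨i.1, by have := i.isLt; omega⟩

/-- the variable `x_j` among the `q`'s. -/
def xVar (n k : ℕ) (j : Fin (n + 1)) : Fin (n + k + 1) := ⟨k + j.1, by have := j.isLt; omega⟩

/-- The Dwork potential `S = Σ_{i=1}^k y_i · G_i(x)`. -/
noncomputable def dwork (n k : ℕ) (G : Fin k → MvPolynomial (Fin (n + 1)) ℂ) : CoordRing n k :=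
  ∑ i : Fin k, X (yVar n k i) * rename (xVar n k) (G i)

/-- The odd derivation `∂/∂η_i` of `𝒜` (A-linear, with `∂η_j/∂η_i = δ_{ij}`). -/
noncomputable def etaDeriv (n k : ℕ) (i : Fin (n + k + 1)) (f : SuperAlg n k) : SuperAlg n k :=
  fun s =>
    if i ∈ s then 0
    else (-1 : CoordRing n k) ^ (s.filter fun j => j < i).card * f (insert i s)

/-- `Q = Σ_i (∂P/∂q_i)·(∂/∂η_i)` for a potential `P`. -/
noncomputable def Qop (n k : ℕ) (P : CoordRing n k) (f : SuperAlg n k) : SuperAlg n k :=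
  fun s => ∑ i : Fin (n + k + 1), pderiv i P * etaDeriv n k i f s

/-- `Δ = Σ_i (∂/∂q_i)(∂/∂η_i)`. -/
noncomputable def Dop (n k : ℕ) (f : SuperAlg n k) : SuperAlg n k :=
  fun s => ∑ i : Fin (n + k + 1), pderiv i (etaDeriv n k i f s)

/-- `K = Q + Δ`. -/
noncomputable def Kop (n k : ℕ) (P : CoordRing n k) (f : SuperAlg n k) : SuperAlg n k :=
  fun s => Qop n k P f s + Dop n k f s

/-- The Koszul sign `(−1)^{#{(i,j) ∈ t×u : i > j}}`. -/
def ksign (n k : ℕ) (t u : Finset (Fin (n + k + 1))) : ℤ :=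
  (-1) ^ ((t ×ˢ u).filter fun p => p.2 < p.1).card

/-- The super-commutative product of `𝒜` (Koszul signs from `η_iη_j = −η_jη_i`). -/
noncomputable def gmul (n k : ℕ) (f g : SuperAlg n k) : SuperAlg n k :=
  fun s => ∑ t ∈ s.powerset, ksign n k t (s \ t) • (f t * g (s \ t))

/-- `f` is homogeneous of `η`-degree `d` (i.e. of cohomological degree `−d`):
it is supported on subsets of cardinality `d`. -/
def IsEDeg (n k : ℕ) (d : ℕ) (f : SuperAlg n k) : Prop :=
  ∀ s : Finset (Fin (n + k + 1)), s.card ≠ d → f s = 0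

/-- The descendant bracket `ℓ₂ᴷ(a,b) = K(a·b) − K(a)·b − (−1)^{|a|}·a·K(b)` for `a`
homogeneous of `η`-degree `da` (so of cohomological degree `|a| = −da`;
only the parity of `da` enters the sign). -/
noncomputable def ell2 (n k : ℕ) (P : CoordRing n k) (da : ℕ) (a b : SuperAlg n k) :
    SuperAlg n k :=
  Kop n k P (gmul n k a b) - gmul n k (Kop n k P a) b
    - ((-1 : ℤ) ^ da) • gmul n k a (Kop n k P b)

/-- The embedding `A ⊆ 𝒜` in degree 0. -/
noncomputable def embA (n k : ℕ) (p : CoordRing n k) : SuperAlg n k := fun s => if s = ∅ then p else 0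

/-- The charge of the variable `q_μ`: `ch(y_i) = −d_i`, `ch(x_j) = 1`. -/
def chq (n k : ℕ) (d : Fin k → ℕ) (μ : Fin (n + k + 1)) : ℤ :=
  if h : (μ : ℕ) < k then -(d ⟨μ, h⟩ : ℤ) else 1

/-- The charge of the monomial `q^m · η_s` (with `ch(η_μ) = −ch(q_μ)`). -/
def chOf (n k : ℕ) (d : Fin k → ℕ) (m : Fin (n + k + 1) →₀ ℕ)
    (s : Finset (Fin (n + k + 1))) : ℤ :=
  (∑ μ : Fin (n + k + 1), (m μ : ℤ) * chq n k d μ) - ∑ μ ∈ s, chq n k d μ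

/-- `f ∈ 𝒜_λ`: every monomial of `f` has charge `λ`. -/
def HasCharge (n k : ℕ) (d : Fin k → ℕ) (lam : ℤ) (f : SuperAlg n k) : Prop :=
  ∀ s : Finset (Fin (n + k + 1)), ∀ m ∈ (f s).support, chOf n k d m s = lam

/-- The weight of the variable `q_μ`: `wt(y_i) = 1`, `wt(x_j) = 0`. -/
def wtq (n k : ℕ) (μ : Fin (n + k + 1)) : ℕ := if (μ : ℕ) < k then 1 else 0

/-- The weight of the monomial `q^m · η_s` (with `wt(η_μ) = 1 − wt(q_μ)`). -/
def wtOf (n k : ℕ) (m : Fin (n + k + 1) →₀ ℕ) (s : Finset (Fin (n + k + 1))) : ℕ :=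
  (∑ μ : Fin (n + k + 1), m μ * wtq n k μ) + (s.filter fun μ : Fin (n + k + 1) => ¬ ((μ : ℕ) < k)).card

/-- `f ∈ 𝒜_{(w)}`: every monomial of `f` has weight `w` (stated with `w : ℤ` so that
`𝒜_{(−1)} = 0` is automatic). -/
def HasWeight (n k : ℕ) (w : ℤ) (f : SuperAlg n k) : Prop :=
  ∀ s : Finset (Fin (n + k + 1)), ∀ m ∈ (f s).support, (wtOf n k m s : ℤ) = w

/-- `f ∈ F^j_wt 𝒜 = ⊕_{0 ≤ w ≤ j} 𝒜_{(w)}`. -/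
def InWtFilt (n k : ℕ) (j : ℕ) (f : SuperAlg n k) : Prop :=
  ∀ s : Finset (Fin (n + k + 1)), ∀ m ∈ (f s).support, wtOf n k m s ≤ j

/-- `R = Σ_μ ch(q_μ)·q_μ·η_μ`. -/
noncomputable def Rel (n k : ℕ) (d : Fin k → ℕ) : SuperAlg n k :=
  fun s => ∑ μ : Fin (n + k + 1), if s = {μ} then chq n k d μ • X μ else 0

/-- The background charge `c_G = Σ_i d_i − (n+1)`. -/
def cG (n k : ℕ) (d : Fin k → ℕ) : ℤ := (∑ i : Fin k, (d i : ℤ)) - (n + 1)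


/-- Left multiplication by `η_μ`. -/
noncomputable def etaMul (n k : ℕ) (μ : Fin (n + k + 1)) (f : SuperAlg n k) : SuperAlg n k :=
  fun s =>
    if μ ∈ s then (-1 : CoordRing n k) ^ (s.filter fun j => j < μ).card * f (s.erase μ)
    else 0

/-- The Euler vector field `Σ_μ ch(q_μ)·q_μ·∂/∂q_μ` of the charge grading. -/
noncomputable def chargeEuler (n k : ℕ) (d : Fin k → ℕ) :
    Derivation ℂ (CoordRing n k) (CoordRing n k) :=
  ∑ μ : Fin (n + k + 1), (chq n k d μ : CoordRing n k) • (X μ : CoordRing n k) • pderiv μ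

theorem chargeEuler_apply (n k : ℕ) (d : Fin k → ℕ) (p : CoordRing n k) :
    chargeEuler n k d p = ∑ μ, (chq n k d μ : CoordRing n k) * (X μ * pderiv μ p) := by
  rw [chargeEuler, ← Derivation.coeFnAddMonoidHom_apply, map_sum, Finset.sum_apply]
  simp [Derivation.coeFnAddMonoidHom]

theorem chargeEuler_X (n k : ℕ) (d : Fin k → ℕ) (i : Fin (n + k + 1)) :
    chargeEuler n k d (X i) = (chq n k d i : CoordRing n k) * X i := by
  rw [chargeEuler_apply, Finset.sum_eq_single i]
  · simp
  · intro μ _ hμ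
    rw [pderiv_X_of_ne hμ.symm, mul_zero, mul_zero]
  · simp

theorem chargeEuler_monomial (n k : ℕ) (d : Fin k → ℕ) (m : Fin (n + k + 1) →₀ ℕ) (a : ℂ) :
    chargeEuler n k d (monomial m a)
      = ((∑ μ, (m μ : ℤ) * chq n k d μ : ℤ) : CoordRing n k) * monomial m a := by
  simp only [chargeEuler_apply, X_mul_pderiv_monomial, nsmul_eq_mul, Int.cast_sum, Finset.sum_mul]
  refine Finset.sum_congr rfl fun μ _ => ?_
  push_cast
  ring

theorem chargeEuler_of_charge (n k : ℕ) (d : Fin k → ℕ) (l : ℤ) (p : CoordRing n k)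
    (h : ∀ m ∈ p.support, ∑ μ, (m μ : ℤ) * chq n k d μ = l) :
    chargeEuler n k d p = (l : CoordRing n k) * p := by
  conv_lhs => rw [p.as_sum]
  conv_rhs => rw [p.as_sum]
  rw [map_sum, Finset.mul_sum]
  refine Finset.sum_congr rfl fun m hm => ?_
  rw [chargeEuler_monomial, h m hm]

theorem chq_yVar (n k : ℕ) (d : Fin k → ℕ) (i : Fin k) :
    chq n k d (yVar n k i) = -(d i : ℤ) := by
  simp [chq, yVar]

theorem chq_xVar (n k : ℕ) (d : Fin k → ℕ) (j : Fin (n + 1)) :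
    chq n k d (xVar n k j) = 1 := by
  simp [chq, xVar]

theorem chargeEuler_rename (n k : ℕ) (d : Fin k → ℕ) (g : MvPolynomial (Fin (n + 1)) ℂ) :
    chargeEuler n k d (rename (xVar n k) g)
      = rename (xVar n k) (∑ j, X j * pderiv j g) := by
  induction g using MvPolynomial.induction_on with
  | C a => simp [MvPolynomial.derivation_C]
  | add p q hp hq => simp only [map_add, hp, hq, mul_add, Finset.sum_add_distrib]
  | mul_X p i hp =>
    have h : ∑ j, X j * pderiv j (p * X i)
        = X i * (∑ j, X j * pderiv j p) + p * X i := by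
      simp only [Derivation.leibniz, smul_eq_mul, mul_add, Finset.sum_add_distrib]
      rw [Finset.sum_eq_single i, pderiv_X_self, Finset.mul_sum,
        Finset.sum_congr rfl fun j _ => mul_left_comm (X j) (X i) (pderiv j p)]
      · ring
      · intro j _ hj
        rw [pderiv_X_of_ne hj.symm, mul_zero, mul_zero]
      · simp
    rw [h, map_mul, Derivation.leibniz, hp, rename_X, chargeEuler_X, chq_xVar]
    simp only [map_add, map_mul, rename_X, smul_eq_mul]
    push_cast
    ring

theorem chargeEuler_dwork (n k : ℕ) (d : Fin k → ℕ) (G : Fin k → MvPolynomial (Fin (n + 1)) ℂ)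
    (hG : ∀ i, (G i).IsHomogeneous (d i)) : chargeEuler n k d (dwork n k G) = 0 := by
  rw [dwork, map_sum]
  refine Finset.sum_eq_zero fun i _ => ?_
  rw [Derivation.leibniz, chargeEuler_rename, (hG i).sum_X_mul_pderiv, chargeEuler_X, chq_yVar]
  simp only [nsmul_eq_mul, smul_eq_mul, map_mul, map_natCast]
  push_cast
  ring

theorem sum_chq (n k : ℕ) (d : Fin k → ℕ) : ∑ μ, chq n k d μ = -cG n k d := by
  have h : k + (n + 1) = n + k + 1 := by omega
  rw [← (finCongr h).sum_comp, Fin.sum_univ_add]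
  have h1 : ∀ i : Fin k, finCongr h (Fin.castAdd (n + 1) i) = yVar n k i := fun i => rfl
  have h2 : ∀ j : Fin (n + 1), finCongr h (Fin.natAdd k j) = xVar n k j := fun j => rfl
  simp only [h1, h2, chq_yVar, chq_xVar, cG]
  simp
  ring

/-- The canonical anticommutation relation `∂_{η_i} η_μ + η_μ ∂_{η_i} = δ_{iμ}`. -/
theorem etaDeriv_etaMul (n k : ℕ) (i μ : Fin (n + k + 1)) (f : SuperAlg n k)
    (s : Finset (Fin (n + k + 1))) :
    etaDeriv n k i (etaMul n k μ f) s
      = (if i = μ then f s else 0) - etaMul n k μ (etaDeriv n k i f) s := by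
  rcases eq_or_ne i μ with rfl | hne
  · by_cases hi : i ∈ s
    · simp [etaDeriv, etaMul, hi, Finset.filter_erase, ← mul_assoc, ← mul_pow]
    · simp [etaDeriv, etaMul, hi, Finset.filter_insert, ← mul_assoc, ← mul_pow]
  · by_cases hi : i ∈ s
    · simp [etaDeriv, etaMul, hi, hne]
    by_cases hm : μ ∈ s
    · have e : (insert i s).erase μ = insert i (s.erase μ) := Finset.erase_insert_of_ne hne
      rcases lt_or_gt_of_ne hne with hlt | hlt
      · simp [etaDeriv, etaMul, hi, hm, hne, Finset.filter_insert, Finset.filter_erase, hlt,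
          hlt.not_gt, e]
        ring
      · have hmem : μ ∈ s.filter fun j => j < i := by simp [hm, hlt]
        have hc := Finset.card_erase_add_one hmem
        simp [etaDeriv, etaMul, hi, hm, hne, Finset.filter_insert, Finset.filter_erase,
          hlt.not_gt, e]
        rw [← hc]
        ring
    · simp [etaDeriv, etaMul, hi, hm, hne, hne.symm]

theorem etaDeriv_sum_mul (n k : ℕ) {ι : Type*} (t : Finset ι) (i : Fin (n + k + 1))
    (a : ι → CoordRing n k) (g : ι → SuperAlg n k) (s : Finset (Fin (n + k + 1))) :
    etaDeriv n k i (fun s => ∑ μ ∈ t, a μ * g μ s) s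
      = ∑ μ ∈ t, a μ * etaDeriv n k i (g μ) s := by
  by_cases h : i ∈ s
  · simp [etaDeriv, h]
  · simp only [etaDeriv, h, if_false, Finset.mul_sum]
    exact Finset.sum_congr rfl fun μ _ => by ring

theorem ksign_singleton (n k : ℕ) (μ : Fin (n + k + 1)) (s : Finset (Fin (n + k + 1))) :
    ksign n k {μ} (s \ {μ}) = (-1) ^ (s.filter fun j => j < μ).card := by
  rw [ksign, Finset.singleton_product, Finset.filter_map, Finset.card_map]
  congr 2
  ext j
  simp only [Finset.mem_filter, Finset.mem_sdiff, Finset.mem_singleton, Function.comp_apply,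
    Function.Embedding.coeFn_mk]
  exact ⟨fun h => ⟨h.1.1, h.2⟩, fun h => ⟨⟨h.1, h.2.ne⟩, h.2⟩⟩

theorem gmul_Rel (n k : ℕ) (d : Fin k → ℕ) (f : SuperAlg n k) :
    gmul n k (Rel n k d) f
      = fun s => ∑ μ, ((chq n k d μ : CoordRing n k) * X μ) * etaMul n k μ f s := by
  funext s
  simp only [gmul, Rel, Finset.sum_mul, Finset.smul_sum]
  rw [Finset.sum_comm]
  refine Finset.sum_congr rfl fun μ _ => ?_
  by_cases hm : μ ∈ s
  · rw [Finset.sum_eq_single {μ}]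
    · rw [ksign_singleton]
      simp only [etaMul, hm, if_true, zsmul_eq_mul, Finset.sdiff_singleton_eq_erase]
      push_cast
      ring
    · intro t _ ht
      simp [ht]
    · intro h
      simp [hm] at h
  · rw [etaMul, if_neg hm, mul_zero]
    refine Finset.sum_eq_zero fun t ht => ?_
    have : t ≠ {μ} := by
      rintro rfl
      simp [hm] at ht
    simp [this]

theorem etaMul_Kop (n k : ℕ) (P : CoordRing n k) (μ : Fin (n + k + 1)) (f : SuperAlg n k)
    (s : Finset (Fin (n + k + 1))) :
    etaMul n k μ (Kop n k P f) s
      = ∑ i, (pderiv i P * etaMul n k μ (etaDeriv n k i f) s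
          + pderiv i (etaMul n k μ (etaDeriv n k i f) s)) := by
  by_cases h : μ ∈ s
  · simp only [etaMul, h, if_true, Kop, Qop, Dop, ← Finset.sum_add_distrib, Finset.mul_sum]
    refine Finset.sum_congr rfl fun i _ => ?_
    have hp : pderiv i ((-1 : CoordRing n k) ^ (s.filter fun j => j < μ).card) = 0 := by
      rw [Derivation.leibniz_pow]
      simp
    rw [pderiv_mul, hp]
    ring
  · simp [etaMul, h]

theorem Kop_apply (n k : ℕ) (P : CoordRing n k) (f : SuperAlg n k)
    (s : Finset (Fin (n + k + 1))) :
    Kop n k P f s = ∑ i, (pderiv i P * etaDeriv n k i f s + pderiv i (etaDeriv n k i f s)) := by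
  rw [Kop, Qop, Dop, Finset.sum_add_distrib]

theorem etaDeriv_etaMul_self (n k : ℕ) (i : Fin (n + k + 1)) (f : SuperAlg n k)
    (s : Finset (Fin (n + k + 1))) :
    etaDeriv n k i (etaMul n k i f) s = if i ∈ s then 0 else f s := by
  rw [etaDeriv_etaMul]
  by_cases h : i ∈ s
  · simp [etaDeriv, etaMul, h, Finset.filter_erase, ← mul_assoc, ← mul_pow]
  · simp [etaMul, h]

/-- `K(R·f) + R·K(f)` is the sum of the action of the Euler field on `P`, the action of the Euler
field on `f`, and the total charge of the `q_μ` whose `η_μ` is absent. -/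
theorem Kop_gmul_Rel (n k : ℕ) (d : Fin k → ℕ) (P : CoordRing n k) (f : SuperAlg n k)
    (s : Finset (Fin (n + k + 1))) :
    Kop n k P (gmul n k (Rel n k d) f) s + gmul n k (Rel n k d) (Kop n k P f) s
      = chargeEuler n k d P * f s + chargeEuler n k d (f s)
        + ∑ μ, (chq n k d μ : CoordRing n k) * (if μ ∈ s then 0 else f s) := by
  have hc : ∀ (i μ : Fin (n + k + 1)), pderiv i (chq n k d μ : CoordRing n k) = 0 :=
    fun i μ => Derivation.map_intCast _ _
  simp only [gmul_Rel, Kop_apply, etaDeriv_sum_mul, etaMul_Kop, map_sum, Finset.mul_sum,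
    ← Finset.sum_add_distrib (s := Finset.univ), chargeEuler_apply, Finset.sum_mul]
  simp only [Finset.sum_add_distrib]
  rw [Finset.sum_comm, Finset.sum_comm (f := fun i μ => pderiv i _)]
  simp only [← Finset.sum_add_distrib]
  refine Finset.sum_congr rfl fun μ _ => ?_
  rw [Finset.sum_eq_single μ]
  · have h : etaMul n k μ (etaDeriv n k μ f) s = f s - etaDeriv n k μ (etaMul n k μ f) s := by
      rw [etaDeriv_etaMul]
      simp
    rw [h, ← etaDeriv_etaMul_self]
    simp only [pderiv_mul, hc, pderiv_X_self, map_sub]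
    ring
  · intro i _ hi
    rw [etaDeriv_etaMul, if_neg hi]
    simp only [pderiv_mul, hc, pderiv_X_of_ne hi.symm, map_sub, map_zero]
    ring
  · simp

/-- for every `λ ∈ ℤ` and `f ∈ 𝒜_λ`,
`K(R·f) = (λ − c_G)·f − R·K(f)` in `𝒜`. -/
theorem stmt9 (n k : ℕ) (hk : 1 ≤ k) (hkn : k ≤ n)
    (d : Fin k → ℕ) (hd : ∀ i, 1 ≤ d i)
    (G : Fin k → MvPolynomial (Fin (n + 1)) ℂ)
    (hG : ∀ i, (G i).IsHomogeneous (d i)) :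
    ∀ (lam : ℤ) (f : SuperAlg n k), HasCharge n k d lam f →
      Kop n k (dwork n k G) (gmul n k (Rel n k d) f)
        = (lam - cG n k d) • f - gmul n k (Rel n k d) (Kop n k (dwork n k G) f) := by
  intro lam f hf
  funext s
  rw [Pi.sub_apply, Pi.smul_apply, eq_sub_iff_add_eq, Kop_gmul_Rel, chargeEuler_dwork n k d G hG,
    chargeEuler_of_charge n k d (lam + ∑ μ ∈ s, chq n k d μ) (f s)
      fun m hm => by rw [← hf s m hm, chOf]; ring]
  have h : ∑ μ, (chq n k d μ : CoordRing n k) * (if μ ∈ s then 0 else f s)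
      = ((-cG n k d - ∑ μ ∈ s, chq n k d μ : ℤ) : CoordRing n k) * f s := by
    rw [← sum_chq, ← Finset.sum_compl_add_sum s (chq n k d), add_sub_cancel_right, Int.cast_sum,
      Finset.sum_mul, ← Finset.sum_compl_add_sum s, add_eq_left.mpr]
    · exact Finset.sum_congr rfl fun μ hμ => by rw [if_neg (Finset.mem_compl.mp hμ)]
    · exact Finset.sum_eq_zero fun μ hμ => by rw [if_pos hμ, mul_zero]
  rw [h, zsmul_eq_mul]
  push_cast
  ring

end PeriodCI
end

section
/- Let 𝒞 : 𝒜 → ℂ be a ℂ-linear map satisfying 𝒞 ∘ K = 0 (i.e., 𝒞 is a cochain map from (𝒜, K) to (ℂ, 0)). Then for every Γ ∈ A ⊆ 𝒜, every a ∈ 𝒜 and every integer n ≥ 1 one has 𝒞(K(a)·Γⁿ) + n·𝒞(ℓ₂ᴷ(Γ, a)·Γ^{n−1}) = 0. (This is the coefficientwise statement that the deformed functional a ↦ 𝒞(a·e^Γ) annihilates the image of the deformed differential K_Γ = K + ℓ₂ᴷ(Γ, ·).) -/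
open MvPolynomial

namespace PeriodCI

/-- Right multiplication by an element of `A` is pointwise multiplication. -/
lemma gmul_embA (n k : ℕ) (f : SuperAlg n k) (p : CoordRing n k) :
    gmul n k f (embA n k p) = fun s => p * f s := by
  funext s
  unfold gmul
  rw [Finset.sum_eq_single s]
  · simp [embA, ksign, mul_comm]
  · intro t ht hts
    have hne : s \ t ≠ ∅ := fun h =>
      hts (Finset.Subset.antisymm (Finset.mem_powerset.mp ht) (Finset.sdiff_eq_empty_iff_subset.mp h))
    simp [embA, hne]
  · simp

/-- Left multiplication by an element of `A` is pointwise multiplication. -/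
lemma embA_gmul (n k : ℕ) (p : CoordRing n k) (f : SuperAlg n k) :
    gmul n k (embA n k p) f = fun s => p * f s := by
  funext s
  unfold gmul
  rw [Finset.sum_eq_single ∅]
  · simp [embA, ksign]
  · intro t _ ht
    simp [embA, ht]
  · simp

/-- `K` vanishes on `A`. -/
lemma Kop_embA (n k : ℕ) (P p : CoordRing n k) : Kop n k P (embA n k p) = 0 := by
  funext s
  simp [Kop, Qop, Dop, etaDeriv, embA]

lemma etaDeriv_mul (n k : ℕ) (i : Fin (n + k + 1)) (p : CoordRing n k) (f : SuperAlg n k)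
    (s : Finset (Fin (n + k + 1))) :
    etaDeriv n k i (fun t => p * f t) s = p * etaDeriv n k i f s := by
  unfold etaDeriv
  split_ifs <;> ring

/-- The failure of `K` to be `A`-linear is a derivation in the scalar. -/
lemma Kop_mul (n k : ℕ) (P p : CoordRing n k) (f : SuperAlg n k)
    (s : Finset (Fin (n + k + 1))) :
    Kop n k P (fun t => p * f t) s
      = p * Kop n k P f s + ∑ i, pderiv i p * etaDeriv n k i f s := by
  simp only [Kop, Qop, Dop, etaDeriv_mul, Derivation.leibniz, smul_eq_mul, Finset.mul_sum,
    mul_add, ← Finset.sum_add_distrib]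
  refine Finset.sum_congr rfl fun i _ => ?_
  ring

/-- The bracket `ℓ₂ᴷ(Γ, a)` of a scalar `Γ` is `Σ_i (∂Γ/∂q_i)·(∂a/∂η_i)`. -/
lemma ell2_embA (n k : ℕ) (P p : CoordRing n k) (a : SuperAlg n k) :
    ell2 n k P 0 (embA n k p) a = fun s => ∑ i, pderiv i p * etaDeriv n k i a s := by
  funext s
  have hz : gmul n k 0 a = 0 := by
    funext t
    simp [gmul]
  simp [ell2, Kop_embA, embA_gmul, Kop_mul, hz]

/-- if `𝒞 : 𝒜 → ℂ` is a ℂ-linear cochain map `(𝒜, K) → (ℂ, 0)`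
(i.e. `𝒞 ∘ K = 0`), then for every `Γ ∈ A ⊆ 𝒜`, `a ∈ 𝒜` and `m ≥ 1`,
`𝒞(K(a)·Γ^m) + m·𝒞(ℓ₂ᴷ(Γ, a)·Γ^{m−1}) = 0`. -/
theorem stmt13 (n k : ℕ) (hk : 1 ≤ k) (hkn : k ≤ n)
    (d : Fin k → ℕ) (hd : ∀ i, 1 ≤ d i)
    (G : Fin k → MvPolynomial (Fin (n + 1)) ℂ)
    (hG : ∀ i, (G i).IsHomogeneous (d i))
    (C : SuperAlg n k →ₗ[ℂ] ℂ) (hC : ∀ f : SuperAlg n k, C (Kop n k (dwork n k G) f) = 0) :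
    ∀ (Gam : CoordRing n k) (a : SuperAlg n k) (m : ℕ), 1 ≤ m →
      C (gmul n k (Kop n k (dwork n k G) a) (embA n k (Gam ^ m)))
        + m • C (gmul n k (ell2 n k (dwork n k G) 0 (embA n k Gam) a)
            (embA n k (Gam ^ (m - 1)))) = 0 := by
  intro Gam a m _
  rw [← map_nsmul, ← map_add, ← hC fun s => Gam ^ m * a s]
  congr 1
  funext s
  rw [Kop_mul, ell2_embA, gmul_embA, gmul_embA]
  rw [Pi.add_apply, Pi.smul_apply]
  simp only [Derivation.leibniz_pow, smul_eq_mul, nsmul_eq_mul, Finset.mul_sum, mul_assoc]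

end PeriodCI
end
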